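/- For real $\beta>0$, $\int_0^1 \frac{u\,\log(\beta+u)}{\sqrt{u(1-u)}}\,du = \frac{\pi}{2}\Big((\sqrt{\beta}-\sqrt{\beta+1})^2 + 2\log\Big(\frac{\sqrt{\beta}+\sqrt{\beta+1}}{2}\Big)\Big)$. -/

import Mathlib

open Real

lemma aux_circle (r : ℝ) (h0 : 0 < r) (h1 : r < 1) :
    ∫ θ in (0:ℝ)..(2 * π), (1 - cos θ) / 2 * Real.log (1 - 2 * r * cos θ + r ^ 2) = π * r := by
  set g : ℂ → ℂ := fun z => Complex.log (1 - r * z) with hg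
  have hre : ∀ z ∈ Metric.closedBall (0:ℂ) 1, (1 - r * z) ∈ Complex.slitPlane := by
    intro z hz
    left
    have h2 : |z.re| ≤ 1 := (Complex.abs_re_le_norm z).trans (by simpa using hz)
    have := abs_le.1 h2
    simp
    nlinarith
  have hgd : DifferentiableOn ℂ g (Metric.closedBall 0 1) := by
    intro z hz
    apply DifferentiableAt.differentiableWithinAt
    exact DifferentiableAt.clog (by fun_prop) (hre z hz)
  have hds : DifferentiableOn ℂ (dslope g 0) (Metric.closedBall 0 1) :=
    (Complex.differentiableOn_dslope (Metric.closedBall_mem_nhds _ one_pos)).2 hgd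
  set h : ℂ → ℂ := fun z => g z * (1 - z / 2) - dslope g 0 z / 2 with hh
  have hhd : DifferentiableOn ℂ h (Metric.closedBall 0 1) := by
    apply DifferentiableOn.sub
    · exact hgd.mul (by fun_prop)
    · exact hds.div_const 2
  have hg0 : g 0 = 0 := by simp [hg]
  have hderiv : HasDerivAt g (-r : ℂ) 0 := by
    have h3 : HasDerivAt (fun z : ℂ => 1 - (r:ℂ) * z) (-r : ℂ) 0 := by
      simpa using ((hasDerivAt_id (0:ℂ)).const_mul (r:ℂ)).const_sub 1
    have := h3.clog (by simp)
    simpa using this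
  have hh0 : h 0 = r / 2 := by
    simp [hh, hg0, dslope_same, hderiv.deriv]
    ring
  have havg : circleAverage h 0 1 = r / 2 := by
    rw [← hh0]
    apply DiffContOnCl.circleAverage
    simpa using! (hhd.mono (by rw [closure_ball _ one_ne_zero])).diffContOnCl
  have hmem : ∀ θ : ℝ, circleMap 0 1 θ ∈ Metric.closedBall (0:ℂ) 1 := by
    intro θ; simp
  have hint : IntervalIntegrable (fun θ => h (circleMap 0 1 θ)) MeasureTheory.volume 0 (2 * π) := by
    apply Continuous.intervalIntegrable
    exact hhd.continuousOn.comp_continuous (continuous_circleMap 0 1) hmem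
  have hpt : ∀ θ : ℝ, (h (circleMap 0 1 θ)).re
      = (1 - cos θ) / 2 * Real.log (1 - 2 * r * cos θ + r ^ 2) := by
    intro θ
    set z := circleMap 0 1 θ with hz
    have hzn : z ≠ 0 := by rw [hz]; exact circleMap_ne_center one_ne_zero
    have hze : z = Complex.exp (θ * Complex.I) := by simp [hz, circleMap]
    have e1 : h z = ((1 - cos θ : ℝ) : ℂ) * g z := by
      simp only [hh]
      rw [dslope_of_ne _ hzn, slope_def_field, hg0]
      have : ((1 - cos θ : ℝ) : ℂ) = 1 - (z + z⁻¹) / 2 := by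
        rw [hze, ← Complex.exp_neg]
        push_cast
        rw [Complex.cos, neg_mul]
      rw [this]
      field_simp
      ring
    rw [e1, Complex.re_ofReal_mul]
    simp only [hg]
    rw [Complex.log_re]
    have e2 : 1 - 2 * r * cos θ + r ^ 2 = ‖1 - (r:ℂ) * z‖ ^ 2 := by
      rw [← Complex.normSq_eq_norm_sq, Complex.normSq_apply, hze]
      simp [Complex.exp_ofReal_mul_I_re, Complex.exp_ofReal_mul_I_im]
      nlinarith [sin_sq_add_cos_sq θ]
    rw [e2, Real.log_pow]
    push_cast
    ring
  rw [circleAverage_def] at havg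
  have h5 : ∫ θ in (0:ℝ)..(2*π), h (circleMap 0 1 θ) = ((π * r : ℝ) : ℂ) := by
    have hp : (π : ℂ) ≠ 0 := by exact_mod_cast pi_ne_zero
    rw [Complex.real_smul] at havg
    push_cast at havg ⊢
    field_simp at havg
    linear_combination havg
  have h6 := Complex.reCLM.intervalIntegral_comp_comm hint
  rw [h5] at h6
  simpa [hpt] using h6

lemma aux_half (r : ℝ) (h0 : 0 < r) (h1 : r < 1) :
    ∫ θ in (0:ℝ)..π, (1 - cos θ) / 2 * Real.log (1 - 2 * r * cos θ + r ^ 2) = π * r / 2 := by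
  have hA := aux_circle r h0 h1
  set F : ℝ → ℝ := fun θ => (1 - cos θ) / 2 * Real.log (1 - 2 * r * cos θ + r ^ 2) with hF
  have hc : Continuous F := by
    have : ∀ θ : ℝ, 1 - 2 * r * cos θ + r ^ 2 ≠ 0 := by
      intro θ
      nlinarith [cos_le_one θ, sq_nonneg (1 - r), mul_pos (sub_pos.2 h1) (sub_pos.2 h1)]
    apply Continuous.mul (by fun_prop)
    exact Continuous.log (by fun_prop) this
  have hs : ∫ θ in (0:ℝ)..π, F (2 * π - θ) = ∫ θ in π..(2*π), F θ := by
    rw [intervalIntegral.integral_comp_sub_left]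
    congr 1 <;> ring
  have hs2 : ∀ θ, F (2 * π - θ) = F θ := by
    intro θ; simp [hF, Real.cos_two_pi_sub]
  simp only [hs2] at hs
  have := intervalIntegral.integral_add_adjacent_intervals
    (hc.intervalIntegrable (μ := MeasureTheory.volume) 0 π) (hc.intervalIntegrable π (2*π))
  change ∫ θ in (0:ℝ)..(2*π), F θ = _ at hA
  linarith

lemma aux_subst (G : ℝ → ℝ) :
    ∫ u in (0:ℝ)..1, u * G u / Real.sqrt (u * (1 - u))
      = ∫ θ in (0:ℝ)..π, (1 - cos θ) / 2 * G ((1 - cos θ) / 2) := by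
  rw [intervalIntegral.integral_of_le zero_le_one, intervalIntegral.integral_of_le pi_pos.le,
    MeasureTheory.integral_Ioc_eq_integral_Ioo, MeasureTheory.integral_Ioc_eq_integral_Ioo]
  have himg : (fun θ : ℝ => (1 - cos θ) / 2) '' Set.Ioo 0 π = Set.Ioo 0 1 := by
    ext u
    constructor
    · rintro ⟨θ, ⟨ha, hb⟩, rfl⟩
      have hsin := sin_pos_of_pos_of_lt_pi ha hb
      have := sin_sq_add_cos_sq θ
      constructor <;> dsimp only <;> nlinarith
    · rintro ⟨ha, hb⟩
      refine ⟨arccos (1 - 2 * u), ⟨arccos_pos.2 (by linarith), ?_⟩, ?_⟩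
      · refine lt_of_le_of_ne (arccos_le_pi _) ?_
        rw [Ne, arccos_eq_pi]; linarith
      · dsimp only
        rw [cos_arccos (by linarith) (by linarith)]; ring
  rw [← himg, MeasureTheory.integral_image_eq_integral_abs_deriv_smul (f' := fun θ => sin θ / 2)
    measurableSet_Ioo]
  · apply MeasureTheory.setIntegral_congr_fun measurableSet_Ioo
    rintro θ ⟨ha, hb⟩
    have hsin := sin_pos_of_pos_of_lt_pi ha hb
    have e : (1 - cos θ) / 2 * (1 - (1 - cos θ) / 2) = (sin θ / 2) ^ 2 := by
      nlinarith [sin_sq_add_cos_sq θ]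
    dsimp only
    rw [e, Real.sqrt_sq (by positivity), abs_of_pos (by positivity), smul_eq_mul]
    field_simp
  · intro θ _
    have := ((hasDerivAt_cos θ).const_sub 1).div_const 2
    simpa using this.hasDerivWithinAt
  · intro a ha b hb hab
    have hab : (1 - cos a) / 2 = (1 - cos b) / 2 := hab
    exact injOn_cos ⟨ha.1.le, ha.2.le⟩ ⟨hb.1.le, hb.2.le⟩ (by linarith)

/-- `∫₀¹ u·log(β+u)/√(u(1-u)) du = (π/2)((√β - √(β+1))² + 2 log((√β+√(β+1))/2))`
for `β > 0`. -/
theorem integral_mul_log_over_sqrt (β : ℝ) (hβ : 0 < β) :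
    ∫ u in (0:ℝ)..1, u * Real.log (β + u) / Real.sqrt (u * (1 - u))
      = π / 2 * ((Real.sqrt β - Real.sqrt (β + 1)) ^ 2
          + 2 * Real.log ((Real.sqrt β + Real.sqrt (β + 1)) / 2)) := by
  rw [aux_subst (fun u => Real.log (β + u))]
  set a := Real.sqrt β with ha
  set b := Real.sqrt (β + 1) with hb
  have ha2 : a ^ 2 = β := Real.sq_sqrt hβ.le
  have hb2 : b ^ 2 = β + 1 := Real.sq_sqrt (by linarith)
  have hapos : 0 < a := Real.sqrt_pos.2 hβ
  have hbpos : 0 < b := Real.sqrt_pos.2 (by linarith)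
  have hab : a < b := Real.sqrt_lt_sqrt hβ.le (by linarith)
  have hprod : (b - a) * (b + a) = 1 := by linarith [show (b - a) * (b + a) = b ^ 2 - a ^ 2 by ring]
  have hba1 : b - a < 1 := by nlinarith
  set r := (a - b) ^ 2 with hr
  have hr0 : 0 < r := by rw [hr]; nlinarith [mul_pos (sub_pos.2 hab) (sub_pos.2 hab)]
  have hr1 : r < 1 := by nlinarith
  have hkey : ∀ c : ℝ, β + (1 - c) / 2 = (1 - 2 * r * c + r ^ 2) / (4 * r) := by
    intro c
    rw [eq_div_iff (by positivity)]
    have h2 : r * (b + a) ^ 2 = 1 := by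
      rw [hr, show (a - b) ^ 2 * (b + a) ^ 2 = ((b - a) * (b + a)) ^ 2 by ring, hprod]; norm_num
    have h3 : r + (b + a) ^ 2 = 4 * β + 2 := by rw [hr]; linarith [show (a - b)^2 + (b + a) ^ 2 = 2 * a ^ 2 + 2 * b ^ 2 by ring]
    linear_combination (-r) * h3 + h2
  have hpos : ∀ θ : ℝ, 0 < 1 - 2 * r * cos θ + r ^ 2 := by
    intro θ
    nlinarith [cos_le_one θ, mul_pos (sub_pos.2 hr1) (sub_pos.2 hr1)]
  have hL : Real.log (4 * r) = - (2 * Real.log ((a + b) / 2)) := by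
    have : (4 * r) = (((a + b) / 2) ^ 2)⁻¹ := by
      apply eq_inv_of_mul_eq_one_left
      rw [hr]
      linear_combination ((b - a) * (b + a) + 1) * hprod
    rw [this, Real.log_inv, Real.log_pow]; norm_num
  have hcongr : ∀ θ : ℝ, (1 - cos θ) / 2 * Real.log (β + (1 - cos θ) / 2)
      = (1 - cos θ) / 2 * Real.log (1 - 2 * r * cos θ + r ^ 2)
        - (1 - cos θ) / 2 * Real.log (4 * r) := by
    intro θ
    rw [hkey, Real.log_div (hpos θ).ne' (by positivity)]; ring
  simp only [hcongr]
  rw [intervalIntegral.integral_sub, aux_half r hr0 hr1]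
  · have : ∫ θ in (0:ℝ)..π, (1 - cos θ) / 2 * Real.log (4 * r) = π / 2 * Real.log (4 * r) := by
      rw [intervalIntegral.integral_mul_const, intervalIntegral.integral_div,
        intervalIntegral.integral_sub (by simp) (by simp)]
      simp
    rw [this, hL]; ring
  · apply Continuous.intervalIntegrable
    apply Continuous.mul (by fun_prop)
    exact Continuous.log (by fun_prop) (fun θ => (hpos θ).ne')
  · apply Continuous.intervalIntegrable
    fun_prop
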